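/- Let K be a field of characteristic zero, X an irreducible locally nilpotent K-derivation of K[x,y,z] of rank at most 2, u a coordinate of K[x,y,z] with X(u) = 0, and s a minimal local slice of X. Then the K[u]-derivation Y = Jac(u,s,·) of K[x,y,z] is locally nilpotent and irreducible, its ring of constants is K[x,y,z]^Y = K[u,s], and X and Y commute: X∘Y = Y∘X. -/

import Mathlib

noncomputable section

variable (K : Type) [Field K] [CharZero K]

abbrev PolyR (K : Type) [Field K] : Type := MvPolynomial (Fin 3) K

/-- A derivation is locally nilpotent if every element is killed by some iterate. -/
def LND (X : Derivation K (PolyR K) (PolyR K)) : Prop :=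
  ∀ a : PolyR K, ∃ n : ℕ, 0 < n ∧ (⇑X)^[n] a = 0

/-- `X` is irreducible: every common divisor of `X x, X y, X z` is a unit. -/
def IrredDer (X : Derivation K (PolyR K) (PolyR K)) : Prop :=
  ∀ d : PolyR K, (∀ i : Fin 3, d ∣ X (MvPolynomial.X i)) → IsUnit d

def IsCoord (f : PolyR K) : Prop :=
  ∃ g h : PolyR K, Algebra.adjoin K {f, g, h} = ⊤

def IsCoordSys (u v w : PolyR K) : Prop := Algebra.adjoin K {u, v, w} = ⊤

def IsSysOfCoords2 (u v : PolyR K) : Prop :=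
  ∃ w : PolyR K, Algebra.adjoin K {u, v, w} = ⊤

/-- The corank of a derivation: the largest length of a system of coordinates in the kernel. -/
def corank (X : Derivation K (PolyR K) (PolyR K)) : ℕ :=
  sSup {r : ℕ | ∃ l : List (PolyR K), l.length = r ∧ (∀ f ∈ l, X f = 0) ∧
    ∃ m : List (PolyR K), (l ++ m).length = 3 ∧
      Algebra.adjoin K {a : PolyR K | a ∈ l ++ m} = ⊤}

def rankD (X : Derivation K (PolyR K) (PolyR K)) : ℕ := 3 - corank K X

def IsLocalSlice (X : Derivation K (PolyR K) (PolyR K)) (s : PolyR K) : Prop :=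
  X s ≠ 0 ∧ X (X s) = 0

def IsMinLocalSlice (X : Derivation K (PolyR K) (PolyR K)) (s : PolyR K) : Prop :=
  IsLocalSlice K X s ∧ ∀ v : PolyR K, IsLocalSlice K X v → X v ∣ X s →
    ∃ μ : (PolyR K)ˣ, X v = (μ : PolyR K) * X s

/-- `c` generates the plinth ideal `S^X = {X a : X² a = 0}` as an ideal of the constants. -/
def IsPlinthGen (X : Derivation K (PolyR K) (PolyR K)) (c : PolyR K) : Prop :=
  {d : PolyR K | ∃ a : PolyR K, X a = d ∧ X (X a) = 0} =
    {d : PolyR K | ∃ r : PolyR K, X r = 0 ∧ d = r * c}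

/-- `X` is triangulable: triangular in some coordinate system. -/
def Triangulable (X : Derivation K (PolyR K) (PolyR K)) : Prop :=
  ∃ u v w : PolyR K, IsCoordSys K u v w ∧
    X u ∈ (⊥ : Subalgebra K (PolyR K)) ∧
    X v ∈ Algebra.adjoin K {u} ∧
    X w ∈ Algebra.adjoin K {u, v}

/-- Evaluation of `Q ∈ K[u][T]` at `T = t`, with coefficients evaluated at `u`. -/
def ev2 (u t : PolyR K) (Q : Polynomial (Polynomial K)) : PolyR K :=
  Polynomial.eval₂ (Polynomial.aeval u).toRingHom t Q

/-- The Jacobian derivation `Jac(f,g,·)` applied to `h`. -/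
def jacDet (f g h : PolyR K) : PolyR K :=
  Matrix.det !![MvPolynomial.pderiv 0 f, MvPolynomial.pderiv 1 f, MvPolynomial.pderiv 2 f;
    MvPolynomial.pderiv 0 g, MvPolynomial.pderiv 1 g, MvPolynomial.pderiv 2 g;
    MvPolynomial.pderiv 0 h, MvPolynomial.pderiv 1 h, MvPolynomial.pderiv 2 h]


/-! ### General facts on derivations -/

lemma lnd_iter_mul {R B : Type} [CommRing R] [CommRing B] [Algebra R B] (D : Derivation R B B)
    (N : ℕ) : ∀ (n m : ℕ) (a b : B), n + m = N → D^[n+1] a = 0 → D^[m+1] b = 0 →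
      D^[N] (a * b) = (N.choose n : B) * (D^[n] a * D^[m] b) := by
  induction N with
  | zero =>
    intro n m a b h ha hb
    obtain rfl : n = 0 := by omega
    obtain rfl : m = 0 := by omega
    simp
  | succ N ih =>
    intro n m a b h ha hb
    have key : D^[N+1] (a * b) = D^[N] (a * D b) + D^[N] (D a * b) := by
      rw [Function.iterate_succ_apply, D.leibniz, smul_eq_mul, smul_eq_mul, mul_comm b,
        iterate_map_add]
    rw [key]
    rcases n with _ | n
    · have ha' : D a = 0 := by simpa using ha
      obtain rfl : m = N + 1 := by omega
      rw [ih 0 N a (D b) (by omega) ha (by simpa [Function.iterate_succ_apply] using hb), ha']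
      simp [Function.iterate_succ_apply]
    · rcases m with _ | m
      · have hb' : D b = 0 := by simpa using hb
        obtain rfl : n = N := by omega
        rw [ih n 0 (D a) b (by omega) (by simpa [Function.iterate_succ_apply] using ha) hb, hb']
        simp [Function.iterate_succ_apply]
      · rw [ih (n+1) m a (D b) (by omega) ha (by simpa [Function.iterate_succ_apply] using hb),
          ih n (m+1) (D a) b (by omega) (by simpa [Function.iterate_succ_apply] using ha) hb,
          Nat.choose_succ_succ]
        simp only [Function.iterate_succ_apply]
        push_cast
        ring

lemma exists_top_iter {B : Type} [Zero B] (f : B → B) (a : B) (ha : a ≠ 0)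
    (h : ∃ n : ℕ, 0 < n ∧ f^[n] a = 0) : ∃ n : ℕ, f^[n] a ≠ 0 ∧ f^[n+1] a = 0 := by
  classical
  have h' : ∃ n : ℕ, f^[n] a = 0 := let ⟨n, _, hn⟩ := h; ⟨n, hn⟩
  have h0 : Nat.find h' ≠ 0 := by
    intro h0
    have := Nat.find_spec h'
    rw [h0] at this
    exact ha this
  obtain ⟨n, hn⟩ := Nat.exists_eq_succ_of_ne_zero h0
  refine ⟨n, Nat.find_min h' (by omega), ?_⟩
  have := Nat.find_spec h'
  rwa [hn] at this

lemma lnd_fact_closed {R B : Type} [CommRing R] [CommRing B] [IsDomain B] [CharZero B]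
    [Algebra R B] (D : Derivation R B B) (hD : ∀ a, ∃ n : ℕ, 0 < n ∧ D^[n] a = 0)
    (a b : B) (hab : a * b ≠ 0) (h : D (a * b) = 0) : D a = 0 := by
  obtain ⟨n, hn, hn'⟩ := exists_top_iter D a (left_ne_zero_of_mul hab) (hD a)
  obtain ⟨m, hm, hm'⟩ := exists_top_iter D b (right_ne_zero_of_mul hab) (hD b)
  have key := lnd_iter_mul D (n + m) n m a b rfl hn' hm'
  rcases n with _ | n
  · simpa using hn'
  · exfalso
    have h1 : D^[n + 1 + m] (a * b) = 0 := by
      rw [show n + 1 + m = (n + m) + 1 by omega, Function.iterate_succ_apply, h, iterate_map_zero]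
    rw [h1] at key
    have h2 : (((n + 1 + m).choose (n + 1) : ℕ) : B) ≠ 0 := by
      exact_mod_cast (Nat.choose_pos (by omega)).ne'
    exact mul_ne_zero h2 (mul_ne_zero hn hm) key.symm

lemma lnd_dvd_closed {R B : Type} [CommRing R] [CommRing B] [IsDomain B] [CharZero B]
    [Algebra R B] (D : Derivation R B B) (hD : ∀ a, ∃ n : ℕ, 0 < n ∧ D^[n] a = 0)
    (a b : B) (hb : b ≠ 0) (hab : a ∣ b) (h : D b = 0) : D a = 0 := by
  obtain ⟨c, rfl⟩ := hab
  exact lnd_fact_closed D hD a c hb h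

lemma der_algebraic_zero {R B : Type} [CommRing R] [CommRing B] [IsDomain B] [CharZero B]
    [Algebra R B] (D : Derivation R B B) (S : Subalgebra R B) (hS : ∀ x ∈ S, D x = 0)
    (x : B) (hx : IsAlgebraic S x) : D x = 0 := by
  classical
  let DS : Derivation S B B := Derivation.mk'
    { toFun := D
      map_add' := D.map_add
      map_smul' := by
        intro m y
        simp only [Subalgebra.smul_def, smul_eq_mul, D.leibniz, hS m m.2, RingHom.id_apply]
        simp } (fun a b => D.leibniz a b)
  have hchar : CharZero S := ⟨fun a b h => by
    have : ((a : S) : B) = ((b : S) : B) := by rw [h]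
    exact_mod_cast this⟩
  have hex : ∃ n : ℕ, ∃ h : Polynomial S, h ≠ 0 ∧ Polynomial.aeval x h = 0 ∧ h.natDegree = n := by
    obtain ⟨h, h0, h1⟩ := hx
    exact ⟨_, h, h0, h1, rfl⟩
  obtain ⟨h, h0, h1, h2⟩ := Nat.find_spec hex
  have hder : DS (Polynomial.aeval x h) = Polynomial.aeval x (Polynomial.derivative h) • DS x :=
    DS.map_aeval h x
  rw [h1, map_zero] at hder
  have hx' : DS x = D x := rfl
  rw [← hx']
  rcases mul_eq_zero.1 hder.symm with h3 | h3
  · exfalso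
    by_cases h4 : Polynomial.derivative h = 0
    · have h5 := Polynomial.derivative_eq_zero.1 h4
      rw [Polynomial.eq_C_of_natDegree_eq_zero h5] at h1 h0
      rw [Polynomial.aeval_C] at h1
      have : h.coeff 0 = 0 := by
        apply Subtype.ext
        exact h1
      rw [this] at h0
      simp at h0
    · have h5 : h.natDegree ≠ 0 := fun h5 => h4 (by
        rw [Polynomial.eq_C_of_natDegree_eq_zero h5]; simp)
      have h6 := Polynomial.natDegree_derivative_lt h5
      rw [h2] at h6
      exact Nat.find_min hex h6 ⟨_, h4, h3, rfl⟩
  · exact h3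

open MvPolynomial in
/-- The main algebraicity lemma. -/
lemma algebraic_mod_prime {R : Type} [CommRing R] [IsDomain R] [CharZero R]
    (D : Derivation R (MvPolynomial (Fin 2) R) (MvPolynomial (Fin 2) R))
    (p : MvPolynomial (Fin 2) R) (hp : Prime p) (hpC : ∀ r : R, r ≠ 0 → ¬ p ∣ C r)
    (hDp : D p = 0) (hnd : ∃ i, ¬ p ∣ D (X i)) (b : MvPolynomial (Fin 2) R) (hb : p ∣ D b) :
    ∃ m : Polynomial R, m ≠ 0 ∧ p ∣ Polynomial.aeval b m := by
  classical
  set I := Ideal.span {p} with hI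
  have hmem : ∀ x, (Ideal.Quotient.mkₐ R I) x = 0 ↔ p ∣ x := by
    intro x
    rw [Ideal.Quotient.mkₐ_eq_mk, Ideal.Quotient.eq_zero_iff_mem, hI, Ideal.mem_span_singleton]
  have hprime : I.IsPrime := (Ideal.span_singleton_prime hp.ne_zero).2 hp
  have hdom : IsDomain (MvPolynomial (Fin 2) R ⧸ I) := inferInstance
  have hsurj : Function.Surjective (Ideal.Quotient.mkₐ R I) := Ideal.Quotient.mkₐ_surjective R I
  have hinj : Function.Injective (algebraMap R (MvPolynomial (Fin 2) R ⧸ I)) := by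
    rw [injective_iff_map_eq_zero]
    intro r hr
    by_contra hr0
    refine hpC r hr0 ((hmem _).1 ?_)
    rw [← hr, ← MvPolynomial.algebraMap_eq, AlgHom.commutes]
  have hfaith : FaithfulSMul R (MvPolynomial (Fin 2) R ⧸ I) :=
    (faithfulSMul_iff_algebraMap_injective _ _).2 hinj
  have hchar : CharZero (MvPolynomial (Fin 2) R ⧸ I) := charZero_of_injective_algebraMap hinj
  have hd : ∀ x, Ideal.Quotient.mkₐ R I x = 0 → Ideal.Quotient.mkₐ R I (D x) = 0 := by
    intro x hx
    rw [hmem] at hx ⊢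
    obtain ⟨y, rfl⟩ := hx
    rw [D.leibniz, hDp]
    simp
  by_contra hcon
  push Not at hcon
  have htr : Transcendental R (Ideal.Quotient.mkₐ R I b) := by
    rw [transcendental_iff]
    intro m hm
    by_contra hm0
    refine hcon m hm0 ((hmem _).1 ?_)
    rw [← Polynomial.aeval_algHom_apply]
    exact hm
  set T : Set (MvPolynomial (Fin 2) R ⧸ I) := Set.range (fun i => Ideal.Quotient.mkₐ R I (X i)) with hT
  have hadj : Algebra.adjoin R T = ⊤ := by
    have h1 := MvPolynomial.adjoin_range_X (R := R) (σ := Fin 2)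
    have h2 : T = Set.image (Ideal.Quotient.mkₐ R I) (Set.range X) := by
      rw [hT, ← Set.range_comp]; rfl
    rw [h2, Algebra.adjoin_image, h1, Algebra.map_top]
    exact (AlgHom.range_eq_top _).2 hsurj
  have halg : Algebra.IsAlgebraic (Algebra.adjoin R T) (MvPolynomial (Fin 2) R ⧸ I) := by
    constructor
    intro x
    have hx : x ∈ Algebra.adjoin R T := by rw [hadj]; trivial
    exact isAlgebraic_algebraMap (⟨x, hx⟩ : Algebra.adjoin R T)
  obtain ⟨t, htT, htb⟩ := exists_isTranscendenceBasis_subset (R := R) T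
  have htle : Cardinal.mk t ≤ 1 := by
    by_contra hlt
    push Not at hlt
    rw [Cardinal.one_lt_iff_nontrivial] at hlt
    obtain ⟨⟨x, hx⟩, ⟨y, hy⟩, hxy⟩ := hlt
    have hxy' : x ≠ y := fun h => hxy (Subtype.ext h)
    obtain ⟨i, hi⟩ := htT hx
    obtain ⟨j, hj⟩ := htT hy
    have hij : i ≠ j := by
      rintro rfl
      exact hxy' (hi.symm.trans hj)
    have hall : ∀ l : Fin 2, Ideal.Quotient.mkₐ R I (X l) ∈ t := by
      intro l
      have : l = i ∨ l = j := by omega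
      rcases this with rfl | rfl
      · simp only at hi; rw [hi]; exact hx
      · simp only at hj; rw [hj]; exact hy
    have hind : AlgebraicIndependent R (fun l : Fin 2 => Ideal.Quotient.mkₐ R I (X l)) := by
      have := htb.1.comp (fun l : Fin 2 => (⟨_, hall l⟩ : t)) (by
        intro l l' hll
        by_contra hne
        have hll' := congrArg Subtype.val hll
        simp only at hll'
        have h12 : (l = i ∧ l' = j) ∨ (l = j ∧ l' = i) := by omega
        rcases h12 with ⟨rfl, rfl⟩ | ⟨rfl, rfl⟩
        · exact hxy' (hi.symm.trans (hll'.trans hj))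
        · exact hxy' (hi.symm.trans (hll'.symm.trans hj)))
      exact this
    have h0 : MvPolynomial.aeval (fun l : Fin 2 => Ideal.Quotient.mkₐ R I (X l)) p = 0 := by
      have : (MvPolynomial.aeval (fun l : Fin 2 => Ideal.Quotient.mkₐ R I (X l)))
          = Ideal.Quotient.mkₐ R I := by
        ext l; simp
      rw [this]
      exact (hmem p).2 dvd_rfl
    exact hp.ne_zero (hind.eq_zero_of_aeval_eq_zero p h0)
  have htrdeg : Algebra.trdeg R (MvPolynomial (Fin 2) R ⧸ I) ≤ 1 := by
    rw [← htb.cardinalMk_eq_trdeg]; exact htle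
  have hbasis : IsTranscendenceBasis R ![Ideal.Quotient.mkₐ R I b] :=
    (algebraicIndependent_iff_transcendental.2 htr).isTranscendenceBasis_of_lift_trdeg_le_of_finite
      (by simpa using htrdeg)
  have halg2 := hbasis.isAlgebraic
  set Db := Derivation.liftOfSurjective hsurj hd with hDb
  have hDbv : ∀ x, Db (Ideal.Quotient.mkₐ R I x) = Ideal.Quotient.mkₐ R I (D x) :=
    fun x => Derivation.liftOfSurjective_apply hsurj hd x
  have hz : ∀ x ∈ Algebra.adjoin R (Set.range ![Ideal.Quotient.mkₐ R I b]), Db x = 0 := by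
    intro x hx
    have := Derivation.eqOn_adjoin (D1 := Db) (D2 := 0)
      (s := (Set.range ![Ideal.Quotient.mkₐ R I b])) (by
        rintro y ⟨l, rfl⟩
        fin_cases l
        simp only [Derivation.zero_apply]
        exact (hDbv b).trans ((hmem _).2 hb)) hx
    simpa using this
  obtain ⟨i, hi⟩ := hnd
  apply hi
  rw [← hmem, ← hDbv]
  exact der_algebraic_zero Db _ hz _ (halg2.isAlgebraic _)

/-! ### Two variables over a domain -/

open MvPolynomial in
lemma prime_dvd_root {R : Type} [CommRing R] [IsDomain R]
    (p b : MvPolynomial (Fin 2) R) (hp : Prime p) (Q : R → Prop)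
    (hroot : ∀ m : Polynomial R, m ≠ 0 → p ∣ Polynomial.aeval b m → ∃ l, m.IsRoot l ∧ Q l) :
    ∀ (n : ℕ) (m : Polynomial R), m.natDegree = n → m ≠ 0 → p ∣ Polynomial.aeval b m →
      ∃ l, Q l ∧ p ∣ b - C l := by
  intro n
  induction n with
  | zero =>
    intro m hn hm hpm
    obtain ⟨l, hl, hQ⟩ := hroot m hm hpm
    exfalso
    rw [Polynomial.eq_C_of_natDegree_eq_zero hn] at hl hm
    apply hm
    simpa using hl
  | succ n ih =>
    intro m hn hm hpm
    obtain ⟨l, hl, hQ⟩ := hroot m hm hpm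
    obtain ⟨m1, rfl⟩ := Polynomial.dvd_iff_isRoot.2 hl
    have hm1 : m1 ≠ 0 := right_ne_zero_of_mul hm
    rw [Polynomial.natDegree_mul (Polynomial.X_sub_C_ne_zero l) hm1,
      Polynomial.natDegree_X_sub_C] at hn
    rw [map_mul] at hpm
    rcases hp.dvd_or_dvd hpm with h | h
    · refine ⟨l, hQ, ?_⟩
      simpa using h
    · exact ih m1 (by omega) hm1 h

lemma iter_const_mul {R B : Type} [CommRing R] [CommRing B] [Algebra R B] (D : Derivation R B B)
    (x y : B) (hx : D x = 0) (n : ℕ) : D^[n] (x * y) = x * D^[n] y := by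
  induction n with
  | zero => rfl
  | succ n ih => 
    rw [Function.iterate_succ_apply', ih, D.leibniz, hx, Function.iterate_succ_apply']; simp

lemma iter_pow_slice {R B : Type} [CommRing R] [CommRing B] [Algebra R B] (D : Derivation R B B)
    (s : B) (hs : D (D s) = 0) (n : ℕ) : D^[n] (s ^ n) = (n.factorial : B) * D s ^ n := by
  induction n with
  | zero => simp
  | succ n ih =>
    have h : D (s ^ (n + 1)) = (((n + 1 : ℕ) : B) * D s) * s ^ n := by
      rw [D.leibniz_pow]; simp; ring
    rw [Function.iterate_succ_apply, h, iter_const_mul D _ _ (by simp [hs]), ih,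
      Nat.factorial_succ]
    push_cast
    ring

lemma slice_expr {R B : Type} [CommRing R] [CommRing B] [Algebra R B] (D : Derivation R B B)
    (s : B) (hs : D (D s) = 0) (S : Subalgebra R B) (hsS : s ∈ S) (hA : ∀ a, D a = 0 → a ∈ S)
    (n : ℕ) : ∀ b, D^[n] b = 0 → ∃ N k : ℕ, N ≠ 0 ∧ (N : B) * D s ^ k * b ∈ S := by
  induction n with
  | zero =>
    intro b hb
    refine ⟨1, 0, one_ne_zero, ?_⟩
    have : b = 0 := hb
    simp [this]
  | succ n ih =>
    intro b hb
    rw [Function.iterate_succ_apply'] at hb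
    obtain ⟨N, k, hN, hk⟩ := ih ((n.factorial : B) * D s ^ n * b - D^[n] b * s ^ n) (by
      rw [iterate_map_sub, iter_const_mul D _ _ hb, iter_pow_slice D s hs, iter_const_mul]
      · ring
      · rw [D.leibniz, D.leibniz_pow, hs]; simp)
    refine ⟨N * n.factorial, k + n, mul_ne_zero hN n.factorial_ne_zero, ?_⟩
    have h2 : (N : B) * D s ^ k * (D^[n] b * s ^ n) ∈ S :=
      S.mul_mem (S.mul_mem (natCast_mem S N) (S.pow_mem (hA _ hs) k))
        (S.mul_mem (hA _ hb) (S.pow_mem hsS n))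
    convert S.add_mem hk h2 using 1
    push_cast
    ring

open MvPolynomial in
/-- The planar Poisson bracket `{s, ·}`. -/
def pb {R : Type} [CommRing R] (s : MvPolynomial (Fin 2) R) :
    Derivation R (MvPolynomial (Fin 2) R) (MvPolynomial (Fin 2) R) :=
  (pderiv 0 s) • pderiv 1 - (pderiv 1 s) • pderiv 0

open MvPolynomial in
lemma pb_apply {R : Type} [CommRing R] (s b : MvPolynomial (Fin 2) R) :
    pb s b = pderiv 0 s * pderiv 1 b - pderiv 1 s * pderiv 0 b := by
  simp [pb]

lemma pb_symm {R : Type} [CommRing R] (s b : MvPolynomial (Fin 2) R) :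
    pb s b = - pb b s := by
  rw [pb_apply, pb_apply]; ring

lemma pb_self {R : Type} [CommRing R] (s : MvPolynomial (Fin 2) R) : pb s s = 0 := by
  rw [pb_apply]; ring

lemma dvd_der_adjoin {R B : Type} [CommRing R] [CommRing B] [Algebra R B] (D : Derivation R B B)
    (j : B) (T : Set B) (h : ∀ x ∈ T, j ∣ D x) (y : B) (hy : y ∈ Algebra.adjoin R T) :
    j ∣ D y := by
  induction hy using Algebra.adjoin_induction with
  | mem x hx => exact h x hx
  | algebraMap r => simp
  | add x y _ _ hx hy => rw [map_add]; exact dvd_add hx hy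
  | mul x y _ _ hx hy =>
    rw [D.leibniz]
    exact dvd_add (Dvd.dvd.mul_left hy _) (Dvd.dvd.mul_left hx _)

lemma pb_dvd_adjoin {R : Type} [CommRing R] (p s x y : MvPolynomial (Fin 2) R)
    (hx : x ∈ Algebra.adjoin R {p, s}) (hy : y ∈ Algebra.adjoin R {p, s}) :
    pb p s ∣ pb x y := by
  have h1 : ∀ z ∈ ({p, s} : Set (MvPolynomial (Fin 2) R)), pb p s ∣ pb z y := by
    intro z hz
    apply dvd_der_adjoin (pb z) _ _ _ y hy
    intro t ht
    rcases hz with rfl | rfl <;> rcases ht with rfl | rfl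
    · simp [pb_self]
    · exact dvd_rfl
    · rw [pb_symm t]; simp
    · simp [pb_self]
  rw [pb_symm x y, dvd_neg]
  apply dvd_der_adjoin (pb y) _ _ _ x hx
  intro z hz
  rw [pb_symm y z, dvd_neg]
  exact h1 z hz

open MvPolynomial in
lemma pb_vars {R : Type} [CommRing R] (p s : MvPolynomial (Fin 2) R) (g h : R)
    (hx : C g * X 0 ∈ Algebra.adjoin R {p, s}) (hy : C h * X 1 ∈ Algebra.adjoin R {p, s}) :
    pb p s ∣ C (g * h) := by
  have := pb_dvd_adjoin p s _ _ hx hy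
  have e : pb (C g * X 0 : MvPolynomial (Fin 2) R) (C h * X 1) = C (g * h) := by
    rw [pb_apply]
    simp [pderiv_C_mul, pderiv_X, Pi.single_apply]
  rwa [e] at this

open MvPolynomial in
lemma not_dvd_C {R : Type} [CommRing R] [IsDomain R] (p : MvPolynomial (Fin 2) R)
    (hp : p ≠ 0) (h0 : constantCoeff p = 0) (r : R) (hr : r ≠ 0) : ¬ p ∣ C r := by
  intro h
  obtain ⟨b, _, rfl⟩ := (dvd_C_iff_exists hr).1 h
  apply hp
  have : b = 0 := by simpa using h0
  simp [this]

open MvPolynomial in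
lemma totalDegree_pos_of {R : Type} [CommRing R] [IsDomain R] (p : MvPolynomial (Fin 2) R)
    (hp : p ≠ 0) (h0 : constantCoeff p = 0) : p.totalDegree ≠ 0 := by
  intro h
  rw [totalDegree_eq_zero_iff_eq_C] at h
  apply hp
  rw [h]
  have : coeff 0 p = 0 := h0
  rw [this, C_0]

open MvPolynomial in
lemma exists_kernel_gen {R : Type} [CommRing R] [IsDomain R] [IsPrincipalIdealRing R] [CharZero R]
    (D : Derivation R (MvPolynomial (Fin 2) R) (MvPolynomial (Fin 2) R))
    (hD : ∀ a, ∃ n : ℕ, 0 < n ∧ D^[n] a = 0)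
    (s : MvPolynomial (Fin 2) R) (hs0 : D s ≠ 0) (hs : D (D s) = 0) :
    ∃ P, Prime P ∧ D P = 0 ∧ constantCoeff P = 0 := by
  have hex : ∃ b, D b = 0 ∧ b ≠ C (constantCoeff b) := by
    by_contra hcon
    push Not at hcon
    have hmem : ∀ a, D a = 0 → a ∈ Algebra.adjoin R {s, s} := by
      intro a ha
      rw [hcon a ha]
      exact Subalgebra.algebraMap_mem _ _
    have key : ∀ b, ∃ g : R, g ≠ 0 ∧ C g * b ∈ Algebra.adjoin R {s, s} := by
      intro b
      obtain ⟨n, _, hn⟩ := hD b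
      obtain ⟨N, k, hN, hk⟩ := slice_expr D s hs (Algebra.adjoin R {s, s})
        (Algebra.subset_adjoin (by simp)) hmem n b hn
      refine ⟨(N : R) * constantCoeff (D s) ^ k, ?_, ?_⟩
      · refine mul_ne_zero (by exact_mod_cast hN) (pow_ne_zero _ ?_)
        intro h
        rw [hcon _ hs, h] at hs0
        simp at hs0
      · rw [map_mul, map_pow, ← hcon _ hs]
        simpa using hk
    obtain ⟨g, hg, hg'⟩ := key (X 0)
    obtain ⟨h, hh, hh'⟩ := key (X 1)
    have := pb_vars s s g h hg' hh'
    rw [pb_self, zero_dvd_iff] at this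
    rw [C_eq_zero] at this
    exact mul_ne_zero hg hh this
  obtain ⟨b, hb, hb0⟩ := hex
  have hfac : ∀ x : MvPolynomial (Fin 2) R, x ≠ 0 → constantCoeff x = 0 →
      ∃ p, Irreducible p ∧ p ∣ x ∧ constantCoeff p = 0 := by
    intro x
    induction x using WfDvdMonoid.induction_on_irreducible with
    | zero => simp
    | unit u hu =>
      intro _ h
      exfalso
      have := hu.map (constantCoeff (σ := Fin 2) (R := R))
      rw [h] at this
      exact not_isUnit_zero this
    | mul a i ha hi ih =>
      intro h0 h
      rw [map_mul, mul_eq_zero] at h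
      rcases h with h | h
      · exact ⟨i, hi, dvd_mul_right _ _, h⟩
      · obtain ⟨p, h1, h2, h3⟩ := ih ha h
        exact ⟨p, h1, h2.mul_left _, h3⟩
  have hne : b - C (constantCoeff b) ≠ 0 := sub_ne_zero.2 hb0
  obtain ⟨p, h1, h2, h3⟩ := hfac (b - C (constantCoeff b)) hne (by simp)
  refine ⟨p, h1.prime, lnd_dvd_closed D hD p _ hne h2 ?_, h3⟩
  rw [map_sub, hb, ← algebraMap_eq, D.map_algebraMap, sub_zero]

open MvPolynomial in
lemma kernel_sub_adjoin {R : Type} [CommRing R] [IsDomain R] [CharZero R]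
    (D : Derivation R (MvPolynomial (Fin 2) R) (MvPolynomial (Fin 2) R))
    (P : MvPolynomial (Fin 2) R) (hP : Prime P) (hDP : D P = 0) (hP0 : constantCoeff P = 0)
    (hnd : ∃ i, ¬ P ∣ D (X i)) (n : ℕ) :
    ∀ b, b.totalDegree ≤ n → D b = 0 → b ∈ Algebra.adjoin R {P} := by
  have hpC := not_dvd_C P hP.ne_zero hP0
  have hdeg := totalDegree_pos_of P hP.ne_zero hP0
  induction n with
  | zero =>
    intro b hb _
    rw [Nat.le_zero, totalDegree_eq_zero_iff_eq_C] at hb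
    rw [hb]
    exact Subalgebra.algebraMap_mem _ _
  | succ n ih =>
    intro b hb hDb
    obtain ⟨m, hm, hm'⟩ := algebraic_mod_prime D P hP hpC hDP hnd b (by simp [hDb])
    obtain ⟨l, rfl, hl⟩ := prime_dvd_root P b hP (fun l => l = constantCoeff b) (by
      intro m hm hpm
      refine ⟨_, ?_, rfl⟩
      obtain ⟨c, hc⟩ := hpm
      have := congrArg (constantCoeff (σ := Fin 2) (R := R)) hc
      rw [map_mul, hP0, zero_mul] at this
      rw [Polynomial.IsRoot.def, ← this, Polynomial.aeval_def, Polynomial.hom_eval₂]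
      have hid : (constantCoeff (σ := Fin 2) (R := R)).comp (algebraMap R _) = RingHom.id R := by
        ext; simp [algebraMap_eq]
      rw [hid]
      rfl) _ m rfl hm hm'
    obtain ⟨c, hc⟩ := hl
    have hb' : b = C (constantCoeff b) + P * c := by rw [← hc]; ring
    by_cases hc0 : c = 0
    · rw [hb', hc0, mul_zero, add_zero]
      exact Subalgebra.algebraMap_mem _ _
    · have h1 : (P * c).totalDegree ≤ n + 1 := by
        rw [← hc]
        refine (totalDegree_sub_C_le _ _).trans hb
      rw [totalDegree_mul_of_isDomain hP.ne_zero hc0] at h1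
      have h2 : D c = 0 := by
        have h3 : D (P * c) = 0 := by
          rw [← hc, map_sub, hDb, ← algebraMap_eq, D.map_algebraMap, sub_zero]
        rw [D.leibniz, hDP, smul_zero, add_zero, smul_eq_mul] at h3
        exact (mul_eq_zero.1 h3).resolve_left hP.ne_zero
      rw [hb']
      exact Subalgebra.add_mem _ (Subalgebra.algebraMap_mem _ _)
        (Subalgebra.mul_mem _ (Algebra.subset_adjoin rfl) (ih c (by omega) h2))

open MvPolynomial in
lemma slice_algClosed {E : Type} [Field E] [IsAlgClosed E] [CharZero E]
    (D : Derivation E (MvPolynomial (Fin 2) E) (MvPolynomial (Fin 2) E))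
    (hD : ∀ a, ∃ n : ℕ, 0 < n ∧ D^[n] a = 0)
    (hcop : ∀ p, Irreducible p → ∃ i, ¬ p ∣ D (X i)) (n : ℕ) :
    ∀ s, (D s).totalDegree ≤ n → D s ≠ 0 → D (D s) = 0 → ∃ t, D t = 1 := by
  have hconst : ∀ s, (D s).totalDegree = 0 → D s ≠ 0 → ∃ t, D t = 1 := by
    intro s h hs0
    rw [totalDegree_eq_zero_iff_eq_C] at h
    refine ⟨(coeff 0 (D s))⁻¹ • s, ?_⟩
    rw [D.map_smul, smul_eq_C_mul, h]
    simp only [coeff_C, if_true]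
    rw [← C_mul, inv_mul_cancel₀, C_1]
    intro h0
    rw [h0] at h
    exact hs0 (by rw [h, C_0])
  induction n with
  | zero => 
    intro s h hs0 hs
    exact hconst s (by omega) hs0
  | succ n ih =>
    intro s h hs0 hs
    by_cases hz : (D s).totalDegree = 0
    · exact hconst s hz hs0
    have hnu : ¬ IsUnit (D s) := by
      intro hu
      exact hz (isUnit_iff_totalDegree_of_isReduced.1 hu).2
    obtain ⟨p, hp, hps⟩ := WfDvdMonoid.exists_irreducible_factor hnu hs0
    have hDp := lnd_dvd_closed D hD p _ hs0 hps hs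
    have hpC : ∀ r : E, r ≠ 0 → ¬ p ∣ C r := by
      intro r hr hd
      exact hp.not_isUnit (isUnit_of_dvd_unit hd ((isUnit_iff_ne_zero.2 hr).map C))
    obtain ⟨m, hm, hm'⟩ := algebraic_mod_prime D p hp.prime hpC hDp (hcop p hp) s hps
    obtain ⟨l, -, hl⟩ := prime_dvd_root p s hp.prime (fun _ => True) (by
      intro m hm hpm
      by_cases hd : m.natDegree = 0
      · exfalso
        rw [Polynomial.eq_C_of_natDegree_eq_zero hd] at hm hpm
        rw [Polynomial.aeval_C] at hpm
        exact hpC _ (by simpa using hm) hpm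
      · obtain ⟨l, hl⟩ := IsAlgClosed.exists_root m (by
          rw [Polynomial.degree_eq_natDegree hm]; exact_mod_cast hd)
        exact ⟨l, hl, trivial⟩) _ m rfl hm hm'
    obtain ⟨c, hc⟩ := hl
    have h3 : D s = p * D c := by
      have : D (s - C l) = D s := by
        rw [map_sub, ← algebraMap_eq, D.map_algebraMap, sub_zero]
      rw [← this, hc, D.leibniz, hDp]; simp
    have hc0 : D c ≠ 0 := fun h0 => hs0 (by rw [h3, h0, mul_zero])
    have hpd : p.totalDegree ≠ 0 := by
      intro h0
      have h1 := totalDegree_eq_zero_iff_eq_C.1 h0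
      refine hpC (coeff 0 p) ?_ (by rw [← h1])
      intro h2
      rw [h2, C_0] at h1
      exact hp.ne_zero h1
    refine ih c ?_ hc0 ?_
    · rw [h3, totalDegree_mul_of_isDomain hp.ne_zero hc0] at h
      omega
    · rw [h3, D.leibniz, hDp, smul_zero, add_zero, smul_eq_mul] at hs
      exact (mul_eq_zero.1 hs).resolve_left hp.ne_zero

/-! ### Descent from the algebraic closure of the fraction field -/

open MvPolynomial in
lemma totalDegree_le_of_coeff {R S : Type} [CommRing R] [CommRing S]
    (p : MvPolynomial (Fin 2) R) (q : MvPolynomial (Fin 2) S)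
    (h : ∀ m, coeff m p ≠ 0 → coeff m q ≠ 0) : p.totalDegree ≤ q.totalDegree := by
  unfold totalDegree
  apply Finset.sup_mono
  intro m hm
  rw [mem_support_iff] at hm ⊢
  exact h m hm

open MvPolynomial in
/-- Apply a linear functional to all coefficients. -/
def coefMap {F E : Type} [Field F] [Field E] [Algebra F E] (φ : E →ₗ[F] F)
    (x : MvPolynomial (Fin 2) E) : MvPolynomial (Fin 2) F :=
  ∑ m ∈ x.support, monomial m (φ (coeff m x))

open MvPolynomial in
lemma coeff_coefMap {F E : Type} [Field F] [Field E] [Algebra F E] (φ : E →ₗ[F] F)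
    (x : MvPolynomial (Fin 2) E) (m) : coeff m (coefMap φ x) = φ (coeff m x) := by
  classical
  rw [coefMap, coeff_sum]
  simp only [coeff_monomial]
  rw [Finset.sum_ite_eq']
  split_ifs with h
  · rfl
  · rw [notMem_support_iff.1 h, map_zero]

open MvPolynomial in
lemma coefMap_add {F E : Type} [Field F] [Field E] [Algebra F E] (φ : E →ₗ[F] F)
    (x y : MvPolynomial (Fin 2) E) : coefMap φ (x + y) = coefMap φ x + coefMap φ y := by
  ext m; simp [coeff_coefMap]

open MvPolynomial in
lemma coefMap_mul {F E : Type} [Field F] [Field E] [Algebra F E] (φ : E →ₗ[F] F)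
    (a : MvPolynomial (Fin 2) F) (x : MvPolynomial (Fin 2) E) :
    coefMap φ (map (algebraMap F E) a * x) = a * coefMap φ x := by
  classical
  ext m
  rw [coeff_coefMap, coeff_mul, coeff_mul, map_sum]
  refine Finset.sum_congr rfl fun i _ => ?_
  rw [coeff_map, ← Algebra.smul_def, map_smul, coeff_coefMap, smul_eq_mul]

open MvPolynomial in
lemma coefMap_pderiv {F E : Type} [Field F] [Field E] [Algebra F E] (φ : E →ₗ[F] F)
    (x : MvPolynomial (Fin 2) E) (i) : coefMap φ (pderiv i x) = pderiv i (coefMap φ x) := by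
  ext m
  rw [coeff_coefMap, coeff_pderiv, coeff_pderiv, coeff_coefMap]
  have : coeff (m + Finsupp.single i 1) x * ((m i : E) + 1)
      = ((m i : F) + 1) • coeff (m + Finsupp.single i 1) x := by
    rw [Algebra.smul_def]; simp [mul_comm]
  rw [this, map_smul, smul_eq_mul, mul_comm]

lemma exists_functional {F E : Type} [Field F] [Field E] [Algebra F E] (e : E) (he : e ≠ 0) :
    ∃ φ : E →ₗ[F] F, φ e = 1 := by
  obtain ⟨g, hg⟩ := (LinearMap.toSpanSingleton F E e).exists_leftInverse_of_injective
    (LinearMap.ker_toSpanSingleton F he)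
  refine ⟨g, ?_⟩
  have := LinearMap.congr_fun hg 1
  simpa using this

open MvPolynomial in
lemma clear_den {R F : Type} [CommRing R] [IsDomain R] [Field F] [Algebra R F]
    [IsFractionRing R F] (y : MvPolynomial (Fin 2) F) :
    ∃ (r : R) (z : MvPolynomial (Fin 2) R), r ≠ 0 ∧
      C (algebraMap R F r) * y = map (algebraMap R F) z := by
  induction y using MvPolynomial.induction_on' with
  | monomial m a =>
    obtain ⟨x, r, hr, rfl⟩ := IsFractionRing.div_surjective (A := R) a
    have hr0 : r ≠ 0 := nonZeroDivisors.ne_zero hr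
    refine ⟨r, monomial m x, hr0, ?_⟩
    have : algebraMap R F r ≠ 0 := by
      simpa using hr0
    rw [C_mul_monomial, map_monomial]
    congr 1
    field_simp
  | add p q hp hq =>
    obtain ⟨r, z, hr, hz⟩ := hp
    obtain ⟨r', z', hr', hz'⟩ := hq
    refine ⟨r * r', C r' * z + C r * z', mul_ne_zero hr hr', ?_⟩
    simp only [map_add, map_mul, map_C]
    rw [← hz, ← hz']
    ring

open MvPolynomial in
lemma der_eq {R : Type} [CommRing R]
    (D : Derivation R (MvPolynomial (Fin 2) R) (MvPolynomial (Fin 2) R)) (b) :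
    D b = D (X 0) * pderiv 0 b + D (X 1) * pderiv 1 b := by
  have : D = D (X 0) • pderiv 0 + D (X 1) • pderiv 1 := by
    apply MvPolynomial.derivation_ext
    intro i
    fin_cases i <;> simp [pderiv_X]
  conv_lhs => rw [this]
  simp

open MvPolynomial in
lemma exists_slice_base {R : Type} [CommRing R] [IsDomain R] [IsPrincipalIdealRing R] [CharZero R]
    (D : Derivation R (MvPolynomial (Fin 2) R) (MvPolynomial (Fin 2) R))
    (hD : ∀ a, ∃ n : ℕ, 0 < n ∧ D^[n] a = 0)
    (hirr : ∀ d, (∀ i, d ∣ D (X i)) → IsUnit d)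
    (s : MvPolynomial (Fin 2) R) (hs0 : D s ≠ 0) (hs : D (D s) = 0) :
    ∃ (t : MvPolynomial (Fin 2) R) (c : R), c ≠ 0 ∧ D t = C c := by
  let F := FractionRing R
  let E := AlgebraicClosure F
  have hinjF : Function.Injective (algebraMap R F) := IsFractionRing.injective R F
  have hinjE : Function.Injective (algebraMap F E) := (algebraMap F E).injective
  have hF0 : CharZero F := charZero_of_injective_algebraMap hinjF
  have hE0 : CharZero E := charZero_of_injective_algebraMap hinjE
  let ι : R →+* E := (algebraMap F E).comp (algebraMap R F)
  have hι : Function.Injective ι := hinjE.comp hinjF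
  have hmapF : Function.Injective (map (σ := Fin 2) (algebraMap R F)) := map_injective _ hinjF
  have hmapE : Function.Injective (map (σ := Fin 2) ι) := map_injective _ hι
  have hmm : ∀ a : MvPolynomial (Fin 2) R,
      map (algebraMap F E) (map (algebraMap R F) a) = map ι a := fun a => map_map _ _ _
  let DE : Derivation E (MvPolynomial (Fin 2) E) (MvPolynomial (Fin 2) E) :=
    map ι (D (X 0)) • pderiv 0 + map ι (D (X 1)) • pderiv 1
  have hDE : ∀ x, DE x = map ι (D (X 0)) * pderiv 0 x + map ι (D (X 1)) * pderiv 1 x := by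
    intro x; simp [DE]
  have hDEm : ∀ b, DE (map ι b) = map ι (D b) := by
    intro b
    rw [hDE, der_eq D b, pderiv_map, pderiv_map]
    simp
  have hDEi : ∀ n b, DE^[n] (map ι b) = map ι (D^[n] b) := by
    intro n b
    induction n with
    | zero => rfl
    | succ n ih => rw [Function.iterate_succ_apply', ih, hDEm, Function.iterate_succ_apply']
  have hzero : ∀ (n m : ℕ) x, n ≤ m → DE^[n] x = 0 → DE^[m] x = 0 := by
    intro n m x hnm hx
    obtain ⟨k, rfl⟩ := Nat.exists_eq_add_of_le hnm
    rw [add_comm, Function.iterate_add_apply, hx, iterate_map_zero]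
  have hLND : ∀ a, ∃ n : ℕ, 0 < n ∧ DE^[n] a = 0 := by
    intro a
    induction a using MvPolynomial.induction_on' with
    | monomial m e =>
      obtain ⟨n, hn, h⟩ := hD (monomial m 1)
      refine ⟨n, hn, ?_⟩
      have : monomial m e = C e * map ι (monomial m 1) := by
        rw [map_monomial, C_mul_monomial]; simp
      rw [this, iter_const_mul DE _ _ (by rw [← algebraMap_eq, DE.map_algebraMap]), hDEi, h]
      simp
    | add p q hp hq =>
      obtain ⟨n, hn, h⟩ := hp
      obtain ⟨n', hn', h'⟩ := hq
      refine ⟨n + n', by omega, ?_⟩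
      rw [iterate_map_add, hzero n _ p (by omega) h, hzero n' _ q (by omega) h', add_zero]
  have hX : ∀ i, DE (X i) = map ι (D (X i)) := by
    intro i
    rw [← hDEm, map_X]
  have hcop : ∀ p, Irreducible p → ∃ i, ¬ p ∣ DE (X i) := by
    intro p hp
    by_contra hcon
    push Not at hcon
    have h0 := hcon 0
    have h1 := hcon 1
    rw [hX] at h0 h1
    by_cases hb : D (X 1) = 0
    · have hu : IsUnit (D (X 0)) := by
        apply hirr
        intro i
        fin_cases i
        · exact dvd_rfl
        · change _ ∣ D (X 1)
          rw [hb]; exact dvd_zero _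
      exact hp.not_isUnit (isUnit_of_dvd_unit h0 (hu.map (map ι)))
    · obtain ⟨α, hα⟩ := h0
      obtain ⟨β, hβ⟩ := h1
      have hbE : map ι (D (X 1)) ≠ 0 := by
        rw [Ne, map_eq_zero_iff _ hmapE]; exact hb
      have hβ0 : β ≠ 0 := by
        rintro rfl
        rw [mul_zero] at hβ
        exact hbE hβ
      have hpd : p.totalDegree ≠ 0 := by
        intro h0
        refine hp.not_isUnit (isUnit_iff_totalDegree_of_isReduced.2 ⟨?_, h0⟩)
        rw [totalDegree_eq_zero_iff_eq_C] at h0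
        rw [isUnit_iff_ne_zero]
        intro h2
        rw [h2, C_0] at h0
        exact hp.ne_zero h0
      have hdegβ : β.totalDegree < (D (X 1)).totalDegree := by
        have h2 : (map ι (D (X 1))).totalDegree ≤ (D (X 1)).totalDegree := by
          apply totalDegree_le_of_coeff
          intro m hm h
          rw [coeff_map, h, map_zero] at hm
          exact hm rfl
        rw [hβ, totalDegree_mul_of_isDomain hp.ne_zero hβ0] at h2
        omega
      have hrel : map ι (D (X 0)) * β = map ι (D (X 1)) * α := by
        rw [hα, hβ]; ring
      obtain ⟨m0, hm0⟩ := ne_zero_iff.1 hβ0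
      obtain ⟨φ, hφ⟩ := exists_functional (F := F) _ hm0
      have hrelF : map (algebraMap R F) (D (X 0)) * coefMap φ β
          = map (algebraMap R F) (D (X 1)) * coefMap φ α := by
        rw [← coefMap_mul, ← coefMap_mul, hmm, hmm, hrel]
      obtain ⟨r1, z1, hr1, hz1⟩ := clear_den (R := R) (coefMap φ β)
      obtain ⟨r2, z2, hr2, hz2⟩ := clear_den (R := R) (coefMap φ α)
      have hrelR : D (X 0) * (C r2 * z1) = D (X 1) * (C r1 * z2) := by
        apply hmapF
        simp only [map_mul, map_C]
        rw [← hz1, ← hz2]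
        linear_combination (C (algebraMap R F r2) * C (algebraMap R F r1)) * hrelF
      have hφβ : coefMap φ β ≠ 0 := by
        intro h
        have := coeff_coefMap φ β m0
        rw [h, hφ] at this
        simp at this
      have hz10 : z1 ≠ 0 := by
        rintro rfl
        rw [map_zero, mul_eq_zero] at hz1
        rcases hz1 with h | h
        · rw [C_eq_zero, map_eq_zero_iff _ hinjF] at h
          exact hr1 h
        · exact hφβ h
      have hrp : IsRelPrime (D (X 1)) (D (X 0)) := by
        intro d hd1 hd0
        apply hirr
        intro i
        fin_cases i
        · exact hd0
        · exact hd1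
      have hdvd : D (X 1) ∣ C r2 * z1 :=
        hrp.dvd_of_dvd_mul_left ⟨_, hrelR⟩
      have hCr2 : (C r2 : MvPolynomial (Fin 2) R) ≠ 0 := by simpa using hr2
      have h3 := totalDegree_le_of_dvd_of_isDomain hdvd (mul_ne_zero hCr2 hz10)
      rw [totalDegree_mul_of_isDomain hCr2 hz10, totalDegree_C, zero_add] at h3
      have h4 : z1.totalDegree ≤ β.totalDegree := by
        apply totalDegree_le_of_coeff
        intro m hm h
        apply hm
        have := congrArg (coeff m) hz1
        rw [coeff_C_mul, coeff_coefMap, h, map_zero, mul_zero, coeff_map] at this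
        exact (map_eq_zero_iff _ hinjF).1 this.symm
      omega
  obtain ⟨t, ht⟩ := slice_algClosed DE hLND hcop _ (map ι s) le_rfl
    (by rw [hDEm, Ne, map_eq_zero_iff _ hmapE]; exact hs0)
    (by rw [hDEm, hDEm, hs, map_zero])
  obtain ⟨φ, hφ⟩ := exists_functional (F := F) (E := E) 1 one_ne_zero
  have h1 : coefMap φ (1 : MvPolynomial (Fin 2) E) = 1 := by
    classical
    ext m
    rw [coeff_coefMap, coeff_one, coeff_one]
    split_ifs
    · exact hφ
    · simp
  have hF : map (algebraMap R F) (D (X 0)) * pderiv 0 (coefMap φ t)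
      + map (algebraMap R F) (D (X 1)) * pderiv 1 (coefMap φ t) = 1 := by
    rw [← coefMap_pderiv, ← coefMap_pderiv, ← coefMap_mul, ← coefMap_mul, ← coefMap_add, hmm, hmm,
      ← hDE, ht, h1]
  obtain ⟨r, z, hr, hz⟩ := clear_den (R := R) (coefMap φ t)
  refine ⟨z, r, hr, ?_⟩
  apply hmapF
  rw [der_eq D z]
  simp only [map_add, map_mul, map_C]
  rw [← pderiv_map, ← pderiv_map, ← hz, pderiv_C_mul, pderiv_C_mul]
  linear_combination C (algebraMap R F r) * hF

/-! ### Reduction modulo primes of the base and the core theorem -/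

open MvPolynomial in
lemma aeval_eq_zero_of {R : Type} [CommRing R] [IsDomain R] (Q : MvPolynomial (Fin 2) R)
    (hQ : Q.totalDegree ≠ 0) (n : ℕ) :
    ∀ h : Polynomial R, h.natDegree ≤ n → Polynomial.aeval Q h = 0 → h = 0 := by
  have hQ0 : Q ≠ 0 := by rintro rfl; simp at hQ
  induction n with
  | zero =>
    intro h hn hh
    rw [Nat.le_zero] at hn
    rw [Polynomial.eq_C_of_natDegree_eq_zero hn] at hh ⊢
    rw [Polynomial.aeval_C, algebraMap_eq, C_eq_zero] at hh
    rw [hh, Polynomial.C_0]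
  | succ n ih =>
    intro h hn hh
    have h1 : h = h.divX * Polynomial.X + Polynomial.C (h.coeff 0) :=
      (Polynomial.divX_mul_X_add h).symm
    have h2 : Polynomial.aeval Q h.divX * Q + C (h.coeff 0) = 0 := by
      rw [h1] at hh
      simpa [algebraMap_eq] using hh
    have h3 : h.coeff 0 = 0 := by
      by_contra h3
      have hd : Q ∣ C (h.coeff 0) := by
        refine ⟨-Polynomial.aeval Q h.divX, ?_⟩
        linear_combination h2
      obtain ⟨b, _, rfl⟩ := (dvd_C_iff_exists h3).1 hd
      simp at hQ
    rw [h3, C_0, add_zero] at h2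
    have h4 := (mul_eq_zero.1 h2).resolve_right hQ0
    have h5 := ih h.divX (by rw [Polynomial.natDegree_divX_eq_natDegree_tsub_one]; omega) h4
    rw [h1, h5, h3]
    simp

open MvPolynomial in
lemma mem_range_of_mul {L : Type} [Field L] (Q : MvPolynomial (Fin 2) L)
    (hQ : Q.totalDegree ≠ 0) (f a : Polynomial L) (hf : f ≠ 0) (t : MvPolynomial (Fin 2) L)
    (h : Polynomial.aeval Q f * t = Polynomial.aeval Q a) :
    ∃ k : Polynomial L, t = Polynomial.aeval Q k := by
  have hinj : ∀ h : Polynomial L, Polynomial.aeval Q h = 0 → h = 0 :=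
    fun h => aeval_eq_zero_of Q hQ _ h le_rfl
  let J : Ideal (Polynomial L) :=
    Ideal.comap (Polynomial.aeval Q).toRingHom (Ideal.span {Polynomial.aeval Q f})
  have hJ : ∀ x, x ∈ J ↔ Polynomial.aeval Q f ∣ Polynomial.aeval Q x := by
    intro x
    rw [← Ideal.mem_span_singleton]
    rfl
  obtain ⟨g, hg⟩ := (IsPrincipalIdealRing.principal J).principal
  have hJ' : ∀ x, x ∈ J ↔ g ∣ x := by
    intro x
    rw [hg]
    exact Ideal.mem_span_singleton
  obtain ⟨f1, hf1⟩ := (hJ' f).1 ((hJ f).2 dvd_rfl)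
  obtain ⟨w, hw⟩ := (hJ g).1 ((hJ' g).2 dvd_rfl)
  have hg0 : g ≠ 0 := by rintro rfl; rw [zero_mul] at hf1; exact hf hf1
  have hgQ : Polynomial.aeval Q g ≠ 0 := fun h => hg0 (hinj g h)
  have hu : Polynomial.aeval Q f1 * w = 1 := by
    apply mul_left_cancel₀ hgQ
    rw [mul_one]
    conv_rhs => rw [hw, hf1, map_mul]
    ring
  have hunit : IsUnit (Polynomial.aeval Q f1) := IsUnit.of_mul_eq_one _ hu
  obtain ⟨hc, hd⟩ := isUnit_iff_totalDegree_of_isReduced.1 hunit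
  rw [totalDegree_eq_zero_iff_eq_C] at hd
  have hf1C : f1 = Polynomial.C (coeff 0 (Polynomial.aeval Q f1)) := by
    rw [← sub_eq_zero]
    apply hinj
    rw [map_sub, Polynomial.aeval_C, algebraMap_eq, ← hd, sub_self]
  obtain ⟨k, hk⟩ := (hJ' a).1 ((hJ a).2 ⟨t, h.symm⟩)
  refine ⟨Polynomial.C (coeff 0 (Polynomial.aeval Q f1))⁻¹ * k, ?_⟩
  have hfQ : Polynomial.aeval Q f ≠ 0 := fun h => hf (hinj f h)
  apply mul_left_cancel₀ hfQ
  rw [h, hk, hf1, ← map_mul]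
  congr 1
  have : f1 * Polynomial.C (coeff 0 (Polynomial.aeval Q f1))⁻¹ = 1 := by
    conv_lhs => rw [hf1C]
    rw [← Polynomial.C_mul]
    simp only [Polynomial.aeval_C, algebraMap_eq, coeff_C, if_true]
    rw [mul_inv_cancel₀ (isUnit_iff_ne_zero.1 hc), Polynomial.C_1]
  linear_combination (-g * k) * this

open MvPolynomial in
lemma map_mk_eq_zero {R : Type} [CommRing R] (q : R) (x : MvPolynomial (Fin 2) R) :
    map (Ideal.Quotient.mk (Ideal.span {q})) x = 0 ↔ C q ∣ x := by
  rw [C_dvd_iff_dvd_coeff, MvPolynomial.ext_iff]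
  refine forall_congr' fun m => ?_
  rw [coeff_map, coeff_zero, Ideal.Quotient.eq_zero_iff_mem, Ideal.mem_span_singleton]

lemma poly_map_mk_eq_zero {R : Type} [CommRing R] (q : R) (x : Polynomial R) :
    Polynomial.map (Ideal.Quotient.mk (Ideal.span {q})) x = 0 ↔ Polynomial.C q ∣ x := by
  rw [Polynomial.C_dvd_iff_dvd_coeff, Polynomial.ext_iff]
  refine forall_congr' fun m => ?_
  rw [Polynomial.coeff_map, Polynomial.coeff_zero, Ideal.Quotient.eq_zero_iff_mem,
    Ideal.mem_span_singleton]

open MvPolynomial in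
lemma map_aeval_mk {R S : Type} [CommRing R] [CommRing S] (π : R →+* S)
    (P : MvPolynomial (Fin 2) R) (h : Polynomial R) :
    map π (Polynomial.aeval P h) = Polynomial.aeval (map π P) (h.map π) := by
  rw [Polynomial.aeval_def, Polynomial.aeval_def, Polynomial.hom_eval₂, Polynomial.eval₂_map]
  congr 1
  ext r
  simp [algebraMap_eq]

open MvPolynomial in
lemma totalDegree_mod_ne {R : Type} [CommRing R] (q : R) (s : MvPolynomial (Fin 2) R)
    (h : ∀ r, ¬ C q ∣ s - C r) :
    (map (Ideal.Quotient.mk (Ideal.span {q})) s).totalDegree ≠ 0 := by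
  intro h0
  rw [totalDegree_eq_zero_iff_eq_C] at h0
  apply h (coeff 0 s)
  rw [← map_mk_eq_zero, map_sub, map_C, sub_eq_zero]
  rw [coeff_map] at h0
  exact h0

open MvPolynomial in
lemma dvd_of_aeval_dvd {R : Type} [CommRing R] [IsDomain R] [IsPrincipalIdealRing R]
    (q : R) (hq : Irreducible q) (s : MvPolynomial (Fin 2) R) (h : ∀ r, ¬ C q ∣ s - C r)
    (f : Polynomial R) (hf : C q ∣ Polynomial.aeval s f) : Polynomial.C q ∣ f := by
  have hmax : (Ideal.span {q}).IsMaximal := PrincipalIdealRing.isMaximal_of_irreducible hq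
  rw [← map_mk_eq_zero, map_aeval_mk] at hf
  rw [← poly_map_mk_eq_zero]
  exact aeval_eq_zero_of _ (totalDegree_mod_ne q s h) _ _ le_rfl hf

open MvPolynomial in
lemma adjoin_saturated {R : Type} [CommRing R] [IsDomain R] [IsPrincipalIdealRing R]
    (s : MvPolynomial (Fin 2) R) (hsq : ∀ q, Irreducible q → ∀ r, ¬ C q ∣ s - C r) (g : R) :
    ∀ a, g ≠ 0 → C g * a ∈ Algebra.adjoin R {s} → a ∈ Algebra.adjoin R {s} := by
  induction g using WfDvdMonoid.induction_on_irreducible with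
  | zero => intro a h; exact absurd rfl h
  | unit u hu =>
    intro a _ ha
    obtain ⟨v, hv⟩ := hu.exists_left_inv
    have : a = v • (C u * a) := by
      rw [smul_eq_C_mul, ← mul_assoc, ← C_mul, hv, C_1, one_mul]
    rw [this]
    exact Subalgebra.smul_mem _ ha v
  | mul g q hg hq ih =>
    intro a _ ha
    apply ih a hg
    rw [Algebra.adjoin_singleton_eq_range_aeval] at ha ⊢
    obtain ⟨f, hf⟩ := ha
    have hf' : Polynomial.aeval s f = C (q * g) * a := hf
    obtain ⟨f', rfl⟩ := dvd_of_aeval_dvd q hq s (hsq q hq) f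
      ⟨C g * a, by rw [hf', C_mul]; ring⟩
    refine ⟨f', ?_⟩
    have hCq : (C q : MvPolynomial (Fin 2) R) ≠ 0 := by simpa using hq.ne_zero
    apply mul_left_cancel₀ hCq
    rw [map_mul, Polynomial.aeval_C, algebraMap_eq, C_mul] at hf'
    change C q * Polynomial.aeval s f' = _
    rw [hf']; ring

lemma der_aeval_sub {R B : Type} [CommRing R] [CommRing B]
    [Algebra R B] (D : Derivation R B B) (S : Subalgebra R B) (hS : ∀ x ∈ S, D x = 0)
    (x : B) (h : Polynomial S) :
    D (Polynomial.aeval x h) = Polynomial.aeval x (Polynomial.derivative h) * D x := by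
  let DS : Derivation S B B := Derivation.mk'
    { toFun := D
      map_add' := D.map_add
      map_smul' := by
        intro m y
        simp only [Subalgebra.smul_def, smul_eq_mul, D.leibniz, hS m m.2, RingHom.id_apply]
        simp } (fun a b => D.leibniz a b)
  exact DS.map_aeval h x

lemma der_zero_adjoin {R B : Type} [CommRing R] [CommRing B] [Algebra R B] (D : Derivation R B B)
    (T : Set B) (h : ∀ x ∈ T, D x = 0) (y : B) (hy : y ∈ Algebra.adjoin R T) : D y = 0 := by
  rw [← zero_dvd_iff]
  exact dvd_der_adjoin D 0 T (fun x hx => by rw [h x hx]) y hy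

lemma lnd_adjoin {R B : Type} [CommRing R] [CommRing B] [Algebra R B] (D : Derivation R B B)
    (T : Set B) (h : ∀ x ∈ T, ∃ n, D^[n+1] x = 0) (y : B) (hy : y ∈ Algebra.adjoin R T) :
    ∃ n, D^[n+1] y = 0 := by
  have hzero : ∀ (n m : ℕ) x, n ≤ m → D^[n] x = 0 → D^[m] x = 0 := by
    intro n m x hnm hx
    obtain ⟨k, rfl⟩ := Nat.exists_eq_add_of_le hnm
    rw [add_comm, Function.iterate_add_apply, hx, iterate_map_zero]
  induction hy using Algebra.adjoin_induction with
  | mem x hx => exact h x hx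
  | algebraMap r => exact ⟨0, by simp⟩
  | add x y _ _ hx hy =>
    obtain ⟨n, hn⟩ := hx
    obtain ⟨m, hm⟩ := hy
    refine ⟨n + m, ?_⟩
    rw [iterate_map_add, hzero _ _ x (by omega) hn, hzero _ _ y (by omega) hm, add_zero]
  | mul x y _ _ hx hy =>
    obtain ⟨n, hn⟩ := hx
    obtain ⟨m, hm⟩ := hy
    refine ⟨n + m, ?_⟩
    rw [Function.iterate_succ_apply', lnd_iter_mul D (n + m) n m x y rfl hn hm]
    rw [Function.iterate_succ_apply'] at hn hm
    rw [D.leibniz, D.leibniz, hn, hm, D.map_natCast]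
    simp

open MvPolynomial in
theorem core {R : Type} [CommRing R] [IsDomain R] [IsPrincipalIdealRing R] [CharZero R]
    (hnat : ∀ n : ℕ, n ≠ 0 → IsUnit (n : R))
    (D : Derivation R (MvPolynomial (Fin 2) R) (MvPolynomial (Fin 2) R))
    (hD : ∀ a, ∃ n : ℕ, 0 < n ∧ D^[n] a = 0)
    (hirr : ∀ d, (∀ i, d ∣ D (X i)) → IsUnit d)
    (s : MvPolynomial (Fin 2) R) (hs0 : D s ≠ 0) (hs : D (D s) = 0)
    (hmin : ∀ v, D v ≠ 0 → D (D v) = 0 → D v ∣ D s →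
      ∃ μ : MvPolynomial (Fin 2) R, D v = μ * D s) :
    (∀ a, ∃ n : ℕ, 0 < n ∧ (pb s)^[n] a = 0) ∧
    (∀ d, (∀ i, d ∣ pb s (X i)) → IsUnit d) ∧
    (∀ a, pb s a = 0 ↔ a ∈ Algebra.adjoin R {s}) ∧
    ∀ a, D (pb s a) = pb s (D a) := by
  have hDC : ∀ r : R, D (C r) = 0 := fun r => by rw [← algebraMap_eq, D.map_algebraMap]
  have hDCm : ∀ (r : R) x, D (C r * x) = C r * D x := fun r x => by
    rw [D.leibniz, hDC]; simp
  have hC0 : ∀ r : R, r ≠ 0 → (C r : MvPolynomial (Fin 2) R) ≠ 0 := fun r hr => by simpa using hr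
  obtain ⟨P, hP, hDP, hP0⟩ := exists_kernel_gen D hD s hs0 hs
  have hnd : ∃ i, ¬ P ∣ D (X i) := by
    by_contra hcon
    push Not at hcon
    exact hP.not_isUnit (hirr P hcon)
  have hker : ∀ b, D b = 0 → b ∈ Algebra.adjoin R {P} :=
    fun b hb => kernel_sub_adjoin D P hP hDP hP0 hnd _ b le_rfl hb
  have hker' : ∀ b, D b = 0 → ∃ h : Polynomial R, Polynomial.aeval P h = b := by
    intro b hb
    have := hker b hb
    rwa [Algebra.adjoin_singleton_eq_range_aeval] at this
  have hPk : ∀ h : Polynomial R, D (Polynomial.aeval P h) = 0 := by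
    intro h
    rw [D.map_aeval, hDP, smul_zero]
  have hPq : ∀ q, Irreducible q → ∀ r, ¬ C q ∣ P - C r := by
    intro q hq r hd
    have hdr : q ∣ r := by
      have := map_dvd (constantCoeff (σ := Fin 2) (R := R)) hd
      simpa [hP0] using this
    have hqP : C q ∣ P := by
      have := dvd_add hd (map_dvd (C (σ := Fin 2)) hdr)
      simpa using this
    have hPC : P ∣ C q := by
      obtain ⟨w, hw⟩ := hqP
      rcases hP.irreducible.isUnit_or_isUnit hw with h | h
      · exfalso
        apply hq.not_isUnit
        have := h.map (constantCoeff (σ := Fin 2) (R := R))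
        simpa using this
      · obtain ⟨w', hw'⟩ := h.exists_right_inv
        exact ⟨w', by rw [hw, mul_assoc, hw', mul_one]⟩
    exact not_dvd_C P hP.ne_zero hP0 q hq.ne_zero hPC
  -- a local slice over the base with minimal value
  obtain ⟨c, ⟨hc0, s1, hs1⟩, hcmin⟩ := (wellFounded_dvdNotUnit (α := R)).has_min
    {c : R | c ≠ 0 ∧ ∃ t, D t = C c} (by
      obtain ⟨t, c, hc, ht⟩ := exists_slice_base D hD hirr s hs0 hs
      exact ⟨c, hc, t, ht⟩)
  have claim : ∀ c0 : R, c0 ∣ c → ∀ f, D f = 0 → D (f * s1 - C c0 * s) = 0 → C c0 ∣ f := by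
    intro c0
    induction c0 using WfDvdMonoid.induction_on_irreducible with
    | zero => intro h; exact absurd (zero_dvd_iff.1 h) hc0
    | unit u hu => intro _ f _ _; exact (hu.map C).dvd
    | mul c' q hc' hq ih =>
      intro hdvd f hf ha
      have hqf : C q ∣ f := by
        obtain ⟨fh, hfh⟩ := hker' f hf
        obtain ⟨ah, hah⟩ := hker' _ ha
        have hmax : (Ideal.span {q}).IsMaximal := PrincipalIdealRing.isMaximal_of_irreducible hq
        let _ : Field (R ⧸ Ideal.span {q}) := Ideal.Quotient.field _
        by_cases hz : Polynomial.map (Ideal.Quotient.mk (Ideal.span {q})) fh = 0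
        · rw [poly_map_mk_eq_zero] at hz
          obtain ⟨f', rfl⟩ := hz
          rw [← hfh, map_mul, Polynomial.aeval_C]
          exact dvd_mul_right _ _
        · exfalso
          obtain ⟨k, hk⟩ := mem_range_of_mul (map (Ideal.Quotient.mk (Ideal.span {q})) P)
            (totalDegree_mod_ne q P (hPq q hq))
            (Polynomial.map (Ideal.Quotient.mk (Ideal.span {q})) fh)
            (Polynomial.map (Ideal.Quotient.mk (Ideal.span {q})) ah) hz
            (map (Ideal.Quotient.mk (Ideal.span {q})) s1) (by
              rw [← map_aeval_mk, ← map_aeval_mk, hfh, hah, ← map_mul, ← sub_eq_zero, ← map_sub,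
                map_mk_eq_zero]
              exact ⟨C c' * s, by rw [C_mul]; ring⟩)
          obtain ⟨k', rfl⟩ := Polynomial.map_surjective _ Ideal.Quotient.mk_surjective k
          rw [← map_aeval_mk, ← sub_eq_zero, ← map_sub, map_mk_eq_zero] at hk
          obtain ⟨s', hs'⟩ := hk
          obtain ⟨ce, hce⟩ := (dvd_mul_right q c').trans hdvd
          have hDs' : D s' = C ce := by
            apply mul_left_cancel₀ (hC0 q hq.ne_zero)
            rw [← hDCm, ← hs', map_sub, hPk, sub_zero, hs1, hce, C_mul]
          have hce_ne : ce ≠ 0 := by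
            rintro rfl
            rw [mul_zero] at hce
            exact hc0 hce
          exact hcmin ce ⟨hce_ne, s', hDs'⟩ ⟨hce_ne, q, hq.not_isUnit, by rw [hce, mul_comm]⟩
      obtain ⟨f1, rfl⟩ := hqf
      rw [hDCm, mul_eq_zero] at hf
      have hf1 := hf.resolve_left (hC0 q hq.ne_zero)
      have h1 : C q * f1 * s1 - C (q * c') * s = C q * (f1 * s1 - C c' * s) := by
        rw [C_mul]; ring
      rw [h1, hDCm, mul_eq_zero] at ha
      rw [C_mul]
      exact mul_dvd_mul_left _ (ih ((dvd_mul_left c' q).trans hdvd) f1 hf1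
        (ha.resolve_left (hC0 q hq.ne_zero)))
  have hcs : C c ∣ D s := by
    apply claim c dvd_rfl _ hs
    rw [map_sub, hDCm, D.leibniz, hs, hs1]
    simp [mul_comm]
  obtain ⟨d, hd0, hd⟩ : ∃ d : R, d ≠ 0 ∧ D s = C d := by
    obtain ⟨μ, hμ⟩ := hmin s1 (by rw [hs1]; exact hC0 c hc0) (by rw [hs1, hDC])
      (by rw [hs1]; exact hcs)
    rw [hs1] at hμ
    obtain ⟨d, _, hd⟩ := (dvd_C_iff_exists hc0).1 ⟨μ, by rw [hμ, mul_comm]⟩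
    refine ⟨d, ?_, hd⟩
    rintro rfl
    rw [C_0] at hd
    exact hs0 hd
  have hsq : ∀ q, Irreducible q → ∀ r, ¬ C q ∣ s - C r := by
    rintro q hq r ⟨s', hs'⟩
    have h1 : D s = C q * D s' := by
      rw [← hDCm, ← hs', map_sub, hDC, sub_zero]
    have h2 : D s' ≠ 0 := by
      intro h; rw [h, mul_zero] at h1; exact hs0 h1
    obtain ⟨μ, hμ⟩ := hmin s' h2 (by
      rw [h1, hDCm, mul_eq_zero] at hs
      exact hs.resolve_left (hC0 q hq.ne_zero)) ⟨C q, by rw [h1, mul_comm]⟩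
    have h3 : C q * μ = 1 := by
      apply mul_left_cancel₀ h2
      rw [h1] at hμ
      linear_combination -hμ
    have h4 := (IsUnit.of_mul_eq_one _ h3).map (constantCoeff (σ := Fin 2) (R := R))
    exact hq.not_isUnit (by simpa using h4)
  have hT : ∀ b, ∃ g : R, g ≠ 0 ∧ C g * b ∈ Algebra.adjoin R {P, s} := by
    intro b
    obtain ⟨n, _, hn⟩ := hD b
    obtain ⟨N, k, hN, hk⟩ := slice_expr D s hs (Algebra.adjoin R {P, s})
      (Algebra.subset_adjoin (by simp))
      (fun a ha => Algebra.adjoin_mono (by simp) (hker a ha)) n b hn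
    refine ⟨(N : R) * d ^ k, mul_ne_zero (by exact_mod_cast hN) (pow_ne_zero _ hd0), ?_⟩
    rw [map_mul, map_pow, ← hd]
    simpa using hk
  obtain ⟨j, hj0, hj⟩ : ∃ j : R, j ≠ 0 ∧ pb s P = C j := by
    obtain ⟨g, hg, hg'⟩ := hT (X 0)
    obtain ⟨h, hh, hh'⟩ := hT (X 1)
    have h1 := pb_vars P s g h hg' hh'
    rw [pb_symm, neg_dvd] at h1
    obtain ⟨j, hj, hj'⟩ := (dvd_C_iff_exists (mul_ne_zero hg hh)).1 h1
    refine ⟨j, ?_, hj'⟩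
    rintro rfl
    exact mul_ne_zero hg hh (zero_dvd_iff.1 hj)
  have hYC : ∀ r : R, pb s (C r) = 0 := fun r => by
    rw [← algebraMap_eq, (pb s).map_algebraMap]
  have hYs : ∀ x ∈ Algebra.adjoin R {s}, pb s x = 0 := by
    apply der_zero_adjoin
    rintro x rfl
    exact pb_self _
  refine ⟨?_, ?_, ?_, ?_⟩
  · intro a
    obtain ⟨g, hg, hga⟩ := hT a
    obtain ⟨n, hn⟩ := lnd_adjoin (pb s) {P, s} (by
      rintro x (rfl | rfl)
      · exact ⟨1, by simp [hj, hYC]⟩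
      · exact ⟨0, by simp [pb_self]⟩) _ hga
    refine ⟨n + 1, by omega, ?_⟩
    rw [iter_const_mul _ _ _ (hYC g), mul_eq_zero] at hn
    exact hn.resolve_left (hC0 g hg)
  · intro e he
    have h1 : e ∣ C j := by
      rw [← hj, der_eq (pb s) P]
      exact dvd_add ((he 0).mul_right _) ((he 1).mul_right _)
    obtain ⟨e0, he0, rfl⟩ := (dvd_C_iff_exists hj0).1 h1
    refine IsUnit.map C ?_
    by_contra hnu
    have he00 : e0 ≠ 0 := by
      rintro rfl
      exact hj0 (zero_dvd_iff.1 he0)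
    obtain ⟨q, hq, hqe⟩ := WfDvdMonoid.exists_irreducible_factor hnu he00
    have hdv : ∀ i, C q ∣ pderiv i s := by
      have h2 : ∀ i, C q ∣ pb s (X i) := fun i => (map_dvd C hqe).trans (he i)
      have h20 := h2 0
      have h21 := h2 1
      rw [pb_apply] at h20 h21
      simp [pderiv_X] at h20 h21
      intro i
      fin_cases i
      · exact h21
      · exact h20
    apply hsq q hq (coeff 0 s)
    rw [C_dvd_iff_dvd_coeff]
    intro m
    rw [coeff_sub, coeff_C]
    split_ifs with hm
    · subst hm; simp
    · rw [sub_zero]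
      obtain ⟨i, hi⟩ : ∃ i, m i ≠ 0 := by
        by_contra hcon
        push Not at hcon
        exact hm (Finsupp.ext fun i => (hcon i).symm)
      have h3 := (C_dvd_iff_dvd_coeff _ _).1 (hdv i) (m - Finsupp.single i 1)
      have h4 : m - Finsupp.single i 1 + Finsupp.single i 1 = m := by
        apply tsub_add_cancel_of_le
        rw [Finsupp.single_le_iff]
        omega
      rw [coeff_pderiv, h4] at h3
      have h5 : IsUnit ((((m - Finsupp.single i 1 : Fin 2 →₀ ℕ) i : ℕ) : R) + 1) := by
        have := hnat ((m - Finsupp.single i 1 : Fin 2 →₀ ℕ) i + 1) (by omega)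
        simpa using this
      exact (h5.dvd_mul_right).1 h3
  · intro a
    refine ⟨fun ha => ?_, hYs a⟩
    obtain ⟨g, hg, hga⟩ := hT a
    apply adjoin_saturated s hsq g a hg
    have hset : ({P, s} : Set (MvPolynomial (Fin 2) R)) = {s} ∪ {P} := by
      ext; simp [or_comm]
    rw [hset, Algebra.adjoin_union_eq_adjoin_adjoin, Subalgebra.mem_restrictScalars,
      Algebra.adjoin_singleton_eq_range_aeval (Algebra.adjoin R {s}) P] at hga
    obtain ⟨H, hH⟩ := hga
    have hH' : Polynomial.aeval P H = C g * a := hH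
    have h1 := der_aeval_sub (pb s) _ hYs P H
    rw [hH', (pb s).leibniz, ha, hYC, hj] at h1
    simp only [smul_zero, add_zero] at h1
    have h2 := (mul_eq_zero.1 h1.symm).resolve_right (hC0 j hj0)
    have h3 : Polynomial.derivative H = 0 := by
      by_contra h3
      have := der_algebraic_zero (pb s) _ hYs P ⟨_, h3, h2⟩
      rw [hj] at this
      exact hC0 j hj0 this
    have hchar : CharZero (Algebra.adjoin R {s}) := ⟨fun a b h => by
      have : ((a : Algebra.adjoin R {s}) : MvPolynomial (Fin 2) R)
        = ((b : Algebra.adjoin R {s}) : MvPolynomial (Fin 2) R) := by rw [h]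
      exact_mod_cast this⟩
    have h4 := Polynomial.derivative_eq_zero.1 h3
    rw [Polynomial.eq_C_of_natDegree_eq_zero h4, Polynomial.aeval_C] at hH'
    rw [← hH']
    exact (H.coeff 0).2
  · intro a
    obtain ⟨g, hg, hga⟩ := hT a
    have h1 := der_zero_adjoin ⁅D, pb s⁆ {P, s} (by
      rintro x (rfl | rfl)
      · rw [Derivation.commutator_apply, hj, hDC, hDP, map_zero, sub_zero]
      · rw [Derivation.commutator_apply, pb_self, map_zero, hd, hYC, sub_zero]) _ hga
    rw [← smul_eq_C_mul, Derivation.map_smul, smul_eq_C_mul, mul_eq_zero] at h1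
    have h2 := h1.resolve_left (hC0 g hg)
    rw [Derivation.commutator_apply, sub_eq_zero] at h2
    exact h2

/-! ### Transfer from three variables to two variables over a polynomial base -/

lemma inj_of_surj_endo {B : Type} [CommRing B] [IsNoetherianRing B] (f : B →+* B)
    (hf : Function.Surjective f) : Function.Injective f := by
  let F : ℕ →o Ideal B := ⟨fun n => RingHom.ker (f ^ n), by
    apply monotone_nat_of_le_succ
    intro n x hx
    rw [RingHom.mem_ker] at hx ⊢
    rw [pow_succ', RingHom.mul_def, RingHom.comp_apply, hx, map_zero]⟩
  obtain ⟨n, hn⟩ := monotone_stabilizes_iff_noetherian.2 (inferInstance : IsNoetherian B B) F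
  rw [injective_iff_map_eq_zero]
  intro a ha
  have hsn : Function.Surjective (f ^ n : B →+* B) := by
    rw [RingHom.coe_pow]
    exact hf.iterate n
  obtain ⟨b, rfl⟩ := hsn a
  have h1 : b ∈ F (n + 1) := by
    change b ∈ RingHom.ker (f ^ (n + 1))
    rw [RingHom.mem_ker, pow_succ', RingHom.mul_def, RingHom.comp_apply, ha]
  rw [← hn (n + 1) (by omega)] at h1
  exact h1

open MvPolynomial in
lemma exists_equiv {k : Type} [Field k] (u g h : MvPolynomial (Fin 3) k)
    (hug : Algebra.adjoin k {u, g, h} = ⊤) :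
    ∃ σ : MvPolynomial (Fin 2) (Polynomial k) ≃ₐ[k] MvPolynomial (Fin 3) k,
      (∀ r, σ (C r) = Polynomial.aeval u r) ∧ σ (X 0) = g ∧ σ (X 1) = h := by
  let σ0 : MvPolynomial (Fin 2) (Polynomial k) →ₐ[k] MvPolynomial (Fin 3) k :=
    aevalTower (Polynomial.aeval u) ![g, h]
  have h0 : ∀ r, σ0 (C r) = Polynomial.aeval u r := fun r => aevalTower_C _ _ _
  have h1 : σ0 (X 0) = g := by simp [σ0]
  have h2 : σ0 (X 1) = h := by simp [σ0]
  have hsurj : Function.Surjective σ0 := by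
    rw [← AlgHom.range_eq_top, eq_top_iff, ← hug, Algebra.adjoin_le_iff]
    rintro x (rfl | rfl | rfl)
    · exact ⟨C Polynomial.X, by change σ0 _ = _; rw [h0, Polynomial.aeval_X]⟩
    · exact ⟨X 0, h1⟩
    · exact ⟨X 1, h2⟩
  let τ : MvPolynomial (Fin 3) k ≃ₐ[k] MvPolynomial (Fin 2) (Polynomial k) :=
    (renameEquiv k (_root_.finSuccEquiv 2)).trans (optionEquivRight k (Fin 2))
  have hinj := inj_of_surj_endo ((σ0.comp τ.toAlgHom).toRingHom) (by
    change Function.Surjective (σ0 ∘ τ)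
    exact hsurj.comp τ.surjective)
  have hinj' : Function.Injective σ0 := by
    have : Function.Injective (σ0 ∘ τ) := hinj
    exact (Function.Injective.of_comp_iff' _ τ.bijective).1 this
  exact ⟨AlgEquiv.ofBijective σ0 ⟨hinj', hsurj⟩, h0, h1, h2⟩

open MvPolynomial in
lemma chain_rule {k : Type} [Field k] (u g h : MvPolynomial (Fin 3) k)
    (σ : MvPolynomial (Fin 2) (Polynomial k) ≃ₐ[k] MvPolynomial (Fin 3) k)
    (h0 : ∀ r, σ (C r) = Polynomial.aeval u r) (h1 : σ (X 0) = g) (h2 : σ (X 1) = h)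
    (b : MvPolynomial (Fin 2) (Polynomial k)) :
    ∃ α, ∀ i, pderiv i (σ b) = α * pderiv i u + σ (pderiv 0 b) * pderiv i g +
      σ (pderiv 1 b) * pderiv i h := by
  induction b using MvPolynomial.induction_on with
  | C r =>
    refine ⟨Polynomial.aeval u (Polynomial.derivative r), fun i => ?_⟩
    rw [h0, Derivation.map_aeval]
    simp
  | add p q hp hq =>
    obtain ⟨a, ha⟩ := hp
    obtain ⟨b, hb⟩ := hq
    refine ⟨a + b, fun i => ?_⟩
    simp only [map_add, ha, hb]
    ring
  | mul_X p j hp =>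
    obtain ⟨a, ha⟩ := hp
    refine ⟨a * σ (X j), fun i => ?_⟩
    rw [map_mul, Derivation.leibniz, ha]
    fin_cases j
    · simp [pderiv_X, h1]
      ring
    · simp [pderiv_X, h2]
      ring

open MvPolynomial in
lemma jac_transfer {k : Type} [Field k] (u g h : MvPolynomial (Fin 3) k)
    (σ : MvPolynomial (Fin 2) (Polynomial k) ≃ₐ[k] MvPolynomial (Fin 3) k)
    (h0 : ∀ r, σ (C r) = Polynomial.aeval u r) (h1 : σ (X 0) = g) (h2 : σ (X 1) = h)
    (s b : MvPolynomial (Fin 2) (Polynomial k)) :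
    jacDet k u (σ s) (σ b) = jacDet k u g h * σ (pb s b) := by
  obtain ⟨α, hα⟩ := chain_rule u g h σ h0 h1 h2 s
  obtain ⟨β, hβ⟩ := chain_rule u g h σ h0 h1 h2 b
  unfold jacDet
  simp only [hα, hβ, Matrix.det_fin_three, pb_apply, map_sub, map_mul]
  simp
  ring

open MvPolynomial in
lemma jac_unit {k : Type} [Field k] (u g h : MvPolynomial (Fin 3) k)
    (σ : MvPolynomial (Fin 2) (Polynomial k) ≃ₐ[k] MvPolynomial (Fin 3) k)
    (h0 : ∀ r, σ (C r) = Polynomial.aeval u r) (h1 : σ (X 0) = g) (h2 : σ (X 1) = h) :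
    ∃ κ : k, κ ≠ 0 ∧ jacDet k u g h = C κ := by
  have hx : ∀ j : Fin 3, ∃ v : Fin 3 → MvPolynomial (Fin 3) k, ∀ i,
      pderiv i (X j) = v 0 * pderiv i u + v 1 * pderiv i g + v 2 * pderiv i h := by
    intro j
    obtain ⟨α, hα⟩ := chain_rule u g h σ h0 h1 h2 (σ.symm (X j))
    refine ⟨![α, σ (pderiv 0 (σ.symm (X j))), σ (pderiv 1 (σ.symm (X j)))], fun i => ?_⟩
    have := hα i
    rw [AlgEquiv.apply_symm_apply] at this
    simpa using this
  choose N hN using hx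
  have hmul : (Matrix.of N) * !![pderiv 0 u, pderiv 1 u, pderiv 2 u;
    pderiv 0 g, pderiv 1 g, pderiv 2 g;
    pderiv 0 h, pderiv 1 h, pderiv 2 h] = 1 := by
    ext1 j i
    have := hN j i
    rw [pderiv_X] at this
    rw [Matrix.one_apply, Matrix.mul_apply, Fin.sum_univ_three]
    simp only [Pi.single_apply] at this
    rw [this]
    fin_cases i <;> simp
  have hdet := congrArg Matrix.det hmul
  rw [Matrix.det_mul, Matrix.det_one] at hdet
  have hU : IsUnit (jacDet k u g h) := IsUnit.of_mul_eq_one_right _ hdet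
  obtain ⟨r, hr, hr'⟩ := isUnit_iff_eq_C_of_isReduced.1 hU
  exact ⟨r, hr.ne_zero, hr'⟩

open MvPolynomial in
/-- Transport of a derivation of `k[x,y,z]` killing `u` to a derivation over `k[u]`. -/
lemma exists_transport {k : Type} [Field k] (u : MvPolynomial (Fin 3) k)
    (σ : MvPolynomial (Fin 2) (Polynomial k) ≃ₐ[k] MvPolynomial (Fin 3) k)
    (h0 : ∀ r, σ (C r) = Polynomial.aeval u r)
    (D : Derivation k (MvPolynomial (Fin 3) k) (MvPolynomial (Fin 3) k)) (hDu : D u = 0) :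
    ∃ E : Derivation (Polynomial k) (MvPolynomial (Fin 2) (Polynomial k))
      (MvPolynomial (Fin 2) (Polynomial k)), ∀ b, σ (E b) = D (σ b) := by
  let L : MvPolynomial (Fin 2) (Polynomial k) →ₗ[Polynomial k]
      MvPolynomial (Fin 2) (Polynomial k) :=
    { toFun := fun b => σ.symm (D (σ b))
      map_add' := fun a b => by simp
      map_smul' := fun r a => by
        apply σ.injective
        rw [smul_eq_C_mul, map_mul, D.leibniz, h0, D.map_aeval, hDu, RingHom.id_apply,
          smul_eq_C_mul, map_mul, h0]
        simp }
  refine ⟨Derivation.mk' L fun a b => ?_, fun b => ?_⟩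
  · apply σ.injective
    simp [L]
  · change σ (σ.symm (D (σ b))) = D (σ b)
    simp

/-- For an irreducible locally nilpotent derivation `X` of rank at most 2, a coordinate
`u` with `X u = 0` and a minimal local slice `s`, the Jacobian derivation
`Y = Jac(u,s,·)` is locally nilpotent, irreducible, has ring of constants `K[u,s]`,
and commutes with `X`. -/
theorem jacobian_derivation_props {K : Type} [Field K] [CharZero K]
    (X : Derivation K (PolyR K) (PolyR K))
    (hln : LND K X) (hirr : IrredDer K X) (hrk : rankD K X ≤ 2)
    (u : PolyR K) (hu : IsCoord K u) (hXu : X u = 0)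
    (s : PolyR K) (hs : IsMinLocalSlice K X s) :
    (∀ a : PolyR K, ∃ n : ℕ, 0 < n ∧ (jacDet K u s)^[n] a = 0) ∧
    (∀ d : PolyR K, (∀ i : Fin 3, d ∣ jacDet K u s (MvPolynomial.X i)) → IsUnit d) ∧
    {a : PolyR K | jacDet K u s a = 0} =
      (Algebra.adjoin K {u, s} : Subalgebra K (PolyR K)) ∧
    ∀ a : PolyR K, X (jacDet K u s a) = jacDet K u s (X a) := by
  obtain ⟨g, h, hug⟩ := hu
  obtain ⟨σ, h0, h1, h2⟩ := exists_equiv u g h hug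
  obtain ⟨κ, hκ, hJ⟩ := jac_unit u g h σ h0 h1 h2
  obtain ⟨E, hE⟩ := exists_transport u σ h0 X hXu
  obtain ⟨s, rfl⟩ := σ.surjective s
  have hjac : ∀ b, jacDet K u (σ s) (σ b) = MvPolynomial.C κ * σ (pb s b) := fun b => by
    rw [jac_transfer u g h σ h0 h1 h2, hJ]
  have hCu : IsUnit (MvPolynomial.C κ : PolyR K) := (IsUnit.mk0 κ hκ).map MvPolynomial.C
  have hEit : ∀ n b, σ (E^[n] b) = X^[n] (σ b) := by
    intro n
    induction n with
    | zero => intro b; rfl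
    | succ n ih => intro b; rw [Function.iterate_succ_apply, ih, hE, Function.iterate_succ_apply]
  have hσ0 : ∀ b, σ b = 0 ↔ b = 0 := fun b => map_eq_zero_iff σ σ.injective
  have hσd : ∀ a b, σ a ∣ σ b ↔ a ∣ b := fun a b => map_dvd_iff σ
  have hσu : ∀ a, IsUnit (σ a) ↔ IsUnit a := fun a => MulEquiv.isUnit_map σ
  obtain ⟨c1, c2, c3, c4⟩ := core (R := Polynomial K) (by
      intro n hn
      have h3 : IsUnit (n : K) := IsUnit.mk0 _ (by exact_mod_cast hn)
      have := h3.map (Polynomial.C)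
      simpa using this) E
    (by
      intro a
      obtain ⟨n, hn, hn'⟩ := hln (σ a)
      exact ⟨n, hn, by rw [← hσ0, hEit, hn']⟩)
    (by
      intro d hd
      rw [← hσu]
      apply hirr
      intro i
      obtain ⟨b, hb⟩ := σ.surjective (MvPolynomial.X i)
      rw [← hb, ← hE, hσd, der_eq E b]
      exact dvd_add ((hd 0).mul_right _) ((hd 1).mul_right _))
    s
    (by rw [Ne, ← hσ0, hE]; exact hs.1.1)
    (by rw [← hσ0, hE, hE]; exact hs.1.2)
    (by
      intro v hv hv' hd
      obtain ⟨μ, hμ⟩ := hs.2 (σ v) ⟨by rw [← hE, Ne, hσ0]; exact hv,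
        by rw [← hE, ← hE, hσ0]; exact hv'⟩ (by rw [← hE, ← hE, hσd]; exact hd)
      refine ⟨σ.symm μ, σ.injective ?_⟩
      rw [map_mul, hE, hE, hμ]
      simp)
  refine ⟨?_, ?_, ?_, ?_⟩
  · intro a
    obtain ⟨b, rfl⟩ := σ.surjective a
    obtain ⟨n, hn, hn'⟩ := c1 b
    refine ⟨n, hn, ?_⟩
    have hit : ∀ n b, (jacDet K u (σ s))^[n] (σ b) = MvPolynomial.C κ ^ n * σ ((pb s)^[n] b) := by
      intro n
      induction n with
      | zero => intro b; simp
      | succ n ih =>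
        intro b
        have h5 : jacDet K u (σ s) (σ b) =
            σ (MvPolynomial.C (Polynomial.C κ) * pb s b) := by
          rw [hjac, map_mul, h0, Polynomial.aeval_C]; rfl
        rw [Function.iterate_succ_apply, h5, ih, iter_const_mul, map_mul, h0, Polynomial.aeval_C,
          Function.iterate_succ_apply, pow_succ, mul_assoc]
        · rfl
        · rw [← MvPolynomial.algebraMap_eq, (pb s).map_algebraMap]
    rw [hit, hn', map_zero, mul_zero]
  · intro d hd
    obtain ⟨d, rfl⟩ := σ.surjective d
    rw [hσu]
    apply c2
    have hd' : ∀ i : Fin 3, d ∣ pb s (σ.symm (MvPolynomial.X i)) := by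
      intro i
      have h5 := hd i
      rw [← σ.apply_symm_apply (MvPolynomial.X i), hjac, hCu.dvd_mul_left, hσd] at h5
      exact h5
    have hall : ∀ p : PolyR K, d ∣ pb s (σ.symm p) := by
      intro p
      induction p using MvPolynomial.induction_on with
      | C r =>
        have h6 : σ.symm (MvPolynomial.C r) = MvPolynomial.C (Polynomial.C r) := by
          apply σ.injective
          rw [h0, Polynomial.aeval_C, σ.apply_symm_apply]; rfl
        rw [h6, ← MvPolynomial.algebraMap_eq, (pb s).map_algebraMap]
        exact dvd_zero _
      | add p q hp hq => rw [map_add, map_add]; exact dvd_add hp hq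
      | mul_X p i hp =>
        rw [map_mul, (pb s).leibniz]
        exact dvd_add ((hd' i).mul_left _) (hp.mul_left _)
    intro i
    have := hall (σ (MvPolynomial.X i))
    rwa [σ.symm_apply_apply] at this
  · have hker : ∀ b, b ∈ Algebra.adjoin (Polynomial K) {s} ↔ σ b ∈ Algebra.adjoin K {u, σ s} := by
      intro b
      constructor
      · intro hb
        induction hb using Algebra.adjoin_induction with
        | mem x hx => exact Algebra.subset_adjoin (by rw [Set.mem_singleton_iff.1 hx]; simp)
        | algebraMap r =>
          rw [MvPolynomial.algebraMap_eq, h0]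
          exact Algebra.adjoin_mono (by simp) (Polynomial.aeval_mem_adjoin_singleton K u (p := r))
        | add x y _ _ hx hy => rw [map_add]; exact add_mem hx hy
        | mul x y _ _ hx hy => rw [map_mul]; exact mul_mem hx hy
      · intro hb
        rw [← σ.symm_apply_apply b]
        generalize σ b = p at hb ⊢
        induction hb using Algebra.adjoin_induction with
        | mem x hx =>
          rcases hx with rfl | rfl
          · have h6 : σ.symm x = algebraMap (Polynomial K) _ Polynomial.X := by
              apply σ.injective
              rw [MvPolynomial.algebraMap_eq, h0, Polynomial.aeval_X, σ.apply_symm_apply]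
            rw [h6]
            exact Subalgebra.algebraMap_mem _ _
          · rw [σ.symm_apply_apply]
            exact Algebra.subset_adjoin (by simp)
        | algebraMap r =>
          have h6 : σ.symm (algebraMap K _ r) = algebraMap (Polynomial K) _ (Polynomial.C r) := by
            apply σ.injective
            rw [MvPolynomial.algebraMap_eq, MvPolynomial.algebraMap_eq, h0, Polynomial.aeval_C,
              σ.apply_symm_apply]; rfl
          rw [h6]
          exact Subalgebra.algebraMap_mem _ _
        | add x y _ _ hx hy => rw [map_add]; exact add_mem hx hy
        | mul x y _ _ hx hy => rw [map_mul]; exact mul_mem hx hy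
    ext a
    obtain ⟨b, rfl⟩ := σ.surjective a
    rw [Set.mem_ofPred_eq, hjac, hCu.mul_right_eq_zero, hσ0, c3, hker]
    rfl
  · intro a
    obtain ⟨b, rfl⟩ := σ.surjective a
    rw [hjac, ← hE, hjac, ← c4, hE, X.leibniz, ← MvPolynomial.algebraMap_eq, X.map_algebraMap]
    simp

end
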